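/- Let T be a finite tree of order at least 2 that is not a path. Then γ_M(T) = dim(T) + γ(T) if and only if every exterior major vertex u of T with terminal degree at least 2 is the support vertex of each of its terminal vertices (i.e., u is adjacent to each of its terminal vertices). -/

import Mathlib

open SimpleGraph

variable {V : Type*}

/-- `S` is a resolving set of `G`. -/
def isResolvingSet (G : SimpleGraph V) (S : Set V) : Prop :=
  ∀ x y : V, x ≠ y → ∃ u ∈ S, G.dist u x ≠ G.dist u y

/-- `S` is a dominating set of `G`. -/
def isDominatingSet (G : SimpleGraph V) (S : Set V) : Prop :=
  ∀ x : V, x ∉ S → ∃ u ∈ S, G.Adj u x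

/-- `S` is a metric-locating-dominating set of `G`. -/
def isMLDSet (G : SimpleGraph V) (S : Set V) : Prop :=
  isResolvingSet G S ∧ isDominatingSet G S

/-- `S` is a locating-dominating set of `G`. -/
def isLDSet (G : SimpleGraph V) (S : Set V) : Prop :=
  isDominatingSet G S ∧
    ∀ x ∉ S, ∀ y ∉ S, x ≠ y → G.neighborSet x ∩ S ≠ G.neighborSet y ∩ S

/-- vertices `u` and `v` doubly resolve the pair `{x, y}`. -/
def doublyResolves (G : SimpleGraph V) (u v x y : V) : Prop :=
  (G.dist u x : ℤ) - (G.dist u y : ℤ) ≠ (G.dist v x : ℤ) - (G.dist v y : ℤ)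

/-- the set `S` doubly resolves the pair `{x, y}`. -/
def setDoublyResolves (G : SimpleGraph V) (S : Set V) (x y : V) : Prop :=
  ∃ u ∈ S, ∃ v ∈ S, doublyResolves G u v x y

/-- `S` is a doubly resolving set of `G`. -/
def isDoublyResolvingSet (G : SimpleGraph V) (S : Set V) : Prop :=
  ∀ x y : V, x ≠ y → setDoublyResolves G S x y

/-- the metric dimension `dim G`. -/
noncomputable def metricDim (G : SimpleGraph V) : ℕ :=
  sInf {n | ∃ S : Set V, isResolvingSet G S ∧ S.ncard = n}

/-- the domination number `γ(G)`. -/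
noncomputable def domNum (G : SimpleGraph V) : ℕ :=
  sInf {n | ∃ S : Set V, isDominatingSet G S ∧ S.ncard = n}

/-- the metric-location-domination number `γ_M(G)`. -/
noncomputable def mldNum (G : SimpleGraph V) : ℕ :=
  sInf {n | ∃ S : Set V, isMLDSet G S ∧ S.ncard = n}

/-- the location-domination number `γ_L(G)`. -/
noncomputable def ldNum (G : SimpleGraph V) : ℕ :=
  sInf {n | ∃ S : Set V, isLDSet G S ∧ S.ncard = n}

/-- the minimum cardinality `ψ(G)` of a doubly resolving set. -/
noncomputable def psiNum (G : SimpleGraph V) : ℕ :=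
  sInf {n | ∃ S : Set V, isDoublyResolvingSet G S ∧ S.ncard = n}

/-- a leaf: a vertex of degree 1. -/
def isLeaf (G : SimpleGraph V) (x : V) : Prop := (G.neighborSet x).ncard = 1

/-- a support vertex: a vertex adjacent to some leaf. -/
def isSupport (G : SimpleGraph V) (u : V) : Prop := ∃ x, isLeaf G x ∧ G.Adj u x

/-- a strong support vertex: a vertex adjacent to at least two leaves. -/
def isStrongSupport (G : SimpleGraph V) (u : V) : Prop :=
  2 ≤ {x | isLeaf G x ∧ G.Adj u x}.ncard

/-- `ℓ(G)`: the number of leaves. -/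
noncomputable def numLeaves (G : SimpleGraph V) : ℕ := {x | isLeaf G x}.ncard

/-- `ℓ'(G)`: the number of leaves adjacent to a strong support vertex. -/
noncomputable def numStrongLeaves (G : SimpleGraph V) : ℕ :=
  {x | isLeaf G x ∧ ∃ u, isStrongSupport G u ∧ G.Adj u x}.ncard

/-- a major vertex: a vertex of degree at least 3. -/
def isMajor (G : SimpleGraph V) (u : V) : Prop := 3 ≤ (G.neighborSet u).ncard

/-- `x` is a terminal vertex of the major vertex `u`:
`x` is a leaf and `u` is the major vertex closest to `x`. -/
def isTerminalOf (G : SimpleGraph V) (u x : V) : Prop :=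
  isLeaf G x ∧ isMajor G u ∧ ∀ w, isMajor G w → w ≠ u → G.dist u x < G.dist w x

/-- the terminal degree `ter(u)` of `u`. -/
noncomputable def terDeg (G : SimpleGraph V) (u : V) : ℕ :=
  {x | isTerminalOf G u x}.ncard

/-- `G` is (isomorphic to) a path graph. -/
def isPathGraph (G : SimpleGraph V) : Prop :=
  ∃ n : ℕ, Nonempty (G ≃g SimpleGraph.pathGraph n)

namespace SimpleGraph

variable {G : SimpleGraph V}

/-- The first step of a geodesic. -/
lemma Connected.exists_adj_dist_eq_add_one (hG : G.Connected) {u v : V} (h : u ≠ v) :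
    ∃ p, G.Adj u p ∧ G.dist u v = G.dist p v + 1 := by
  obtain ⟨w, hw⟩ := hG.exists_walk_length_eq_dist u v
  cases w with
  | nil => exact absurd rfl h
  | @cons _ p _ hadj t =>
    refine ⟨p, hadj, ?_⟩
    have h1 := dist_le t
    have h2 : G.dist u v ≤ G.dist u p + G.dist p v := hG.dist_triangle
    rw [dist_eq_one_iff_adj.mpr hadj] at h2
    rw [Walk.length_cons] at hw
    omega

/-- The first step of a geodesic in a tree is unique. -/
lemma IsTree.eq_of_dist_eq_add_one (hG : G.IsTree) {m a b v : V} (ha : G.Adj m a) (hb : G.Adj m b)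
    (hav : G.dist m v = G.dist a v + 1) (hbv : G.dist m v = G.dist b v + 1) : a = b := by
  obtain ⟨p, hp⟩ := hG.connected.exists_walk_length_eq_dist a v
  obtain ⟨q, hq⟩ := hG.connected.exists_walk_length_eq_dist b v
  have hp' : (Walk.cons ha p).IsPath :=
    Walk.isPath_of_length_eq_dist _ (by rw [Walk.length_cons, hp, hav])
  have hq' : (Walk.cons hb q).IsPath :=
    Walk.isPath_of_length_eq_dist _ (by rw [Walk.length_cons, hq, hbv])
  have h := (hG.isAcyclic.subsingleton_path m v).elim ⟨_, hp'⟩ ⟨_, hq'⟩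
  have h' : Walk.cons ha p = Walk.cons hb q := congrArg Subtype.val h
  have := congrArg Walk.snd h'
  simpa using this

/-- Adjacent vertices of a tree have distances to any vertex that differ by exactly one. -/
lemma IsTree.dist_eq_add_one_or (hG : G.IsTree) {m p : V} (h : G.Adj m p) (v : V) :
    G.dist m v = G.dist p v + 1 ∨ G.dist p v = G.dist m v + 1 := by
  classical
  obtain ⟨t, ht, hl⟩ := hG.connected.exists_path_of_dist p v
  have h1 : G.dist p v ≤ G.dist p m + G.dist m v := hG.connected.dist_triangle
  rw [dist_eq_one_iff_adj.mpr h.symm] at h1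
  by_cases hm : m ∈ t.support
  · right
    have h2 := congrArg Walk.length (t.take_spec hm)
    rw [Walk.length_append] at h2
    have h3 := dist_le (t.dropUntil m hm)
    have h4 := dist_le (t.takeUntil m hm)
    rw [dist_eq_one_iff_adj.mpr h.symm] at h4
    omega
  · left
    have hc : (Walk.cons h t).IsPath := ht.cons hm
    obtain ⟨s, hs, hsl⟩ := hG.connected.exists_path_of_dist m v
    have h' : Walk.cons h t = s :=
      congrArg Subtype.val ((hG.isAcyclic.subsingleton_path m v).elim ⟨_, hc⟩ ⟨_, hs⟩)
    rw [← hsl, ← h', Walk.length_cons, hl]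

/-- In a tree, a geodesic between the two sides of an edge uses that edge. -/
lemma IsTree.dist_eq_of_adj (hG : G.IsTree) {m p v : V} (h : G.Adj m p)
    (hv : G.dist m v = G.dist p v + 1) :
    ∀ {w : V}, G.dist p w = G.dist m w + 1 → G.dist v w = G.dist p v + 1 + G.dist m w := by
  suffices H : ∀ n w, G.dist m w = n → G.dist p w = G.dist m w + 1 →
      G.dist v w = G.dist p v + 1 + G.dist m w from fun {w} => H _ w rfl
  have hconn := hG.connected
  intro n
  induction n with
  | zero =>
    intro w hw _
    obtain rfl := hconn.dist_eq_zero_iff.mp hw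
    rw [dist_comm, hv, hw]
  | succ n ih =>
    intro w hw hpw
    have hne : w ≠ m := by
      rintro rfl
      simp at hw
    obtain ⟨w', hadj, hw'⟩ := hconn.exists_adj_dist_eq_add_one hne
    rw [dist_comm, dist_comm (u := w')] at hw'
    have hpw' : G.dist p w' = G.dist m w' + 1 := by
      rcases hG.dist_eq_add_one_or h w' with h1 | h1
      · have h2 : G.dist p w ≤ G.dist p w' + G.dist w' w := hconn.dist_triangle
        rw [dist_eq_one_iff_adj.mpr hadj.symm] at h2
        omega
      · exact h1
    have hi := ih w' (by omega) hpw'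
    rw [dist_comm] at hi ⊢
    rcases hG.dist_eq_add_one_or hadj v with h1 | h1
    · omega
    · exfalso
      by_cases hm : w' = m
      · subst hm
        have := hG.eq_of_dist_eq_add_one hadj.symm h h1 hv
        subst this
        simp at hpw
      · obtain ⟨w'', hadj', hw''⟩ := hconn.exists_adj_dist_eq_add_one hm
        have h2 : G.dist w'' v ≤ G.dist w'' m + G.dist m v := hconn.dist_triangle
        have h3 : G.dist w' v = G.dist w'' v + 1 := by
          rw [dist_comm (u := w') (v := m)] at hw''
          rcases hG.dist_eq_add_one_or hadj' v with h3 | h3 <;> omega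
        have := hG.eq_of_dist_eq_add_one hadj.symm hadj' h1 h3
        subst this
        rw [dist_comm (u := w') (v := m), dist_comm (u := w) (v := m)] at hw''
        omega

/-- In a tree the three distances between three vertices have even sum. -/
lemma IsTree.even_dist_add_dist_add_dist (hG : G.IsTree) (s x y : V) :
    Even (G.dist s x + G.dist s y + G.dist x y) := by
  obtain ⟨w⟩ := hG.connected x y
  rw [dist_comm (u := s), dist_comm (u := s)]
  suffices H : ∀ {a b : V}, G.Walk a b → ∀ z,
      Even (G.dist a s + G.dist b s + (G.dist a z + G.dist b z)) by
    have := H w y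
    simpa using this
  intro a b w z
  induction w with
  | @nil a => exact ⟨G.dist a s + G.dist a z, by ring⟩
  | cons h t ih =>
    rcases hG.dist_eq_add_one_or h s with h1 | h1 <;>
      rcases hG.dist_eq_add_one_or h z with h2 | h2 <;>
      (rw [Nat.even_iff] at ih ⊢; omega)

lemma Connected.exists_dist_eq_add (hG : G.Connected) (x y : V) {k : ℕ} (hk : k ≤ G.dist x y) :
    ∃ m, G.dist x m = k ∧ G.dist x y = k + G.dist m y := by
  induction k with
  | zero => exact ⟨x, by simp⟩
  | succ k ih =>
    obtain ⟨m, h1, h2⟩ := ih (by omega)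
    have hne : m ≠ y := by
      rintro rfl
      simp at h2
      omega
    obtain ⟨p, hadj, hp⟩ := hG.exists_adj_dist_eq_add_one hne
    have h3 : G.dist x p ≤ G.dist x m + G.dist m p := hG.dist_triangle
    have h4 : G.dist x y ≤ G.dist x p + G.dist p y := hG.dist_triangle
    rw [dist_eq_one_iff_adj.mpr hadj] at h3
    exact ⟨p, by omega, by omega⟩

end SimpleGraph

section

variable {G : SimpleGraph V}

lemma isLeaf.eq_of_adj {x a b : V} (h : isLeaf G x) (ha : G.Adj x a) (hb : G.Adj x b) : a = b := by
  obtain ⟨c, hc⟩ := Set.ncard_eq_one.mp h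
  have h1 : a ∈ G.neighborSet x := ha
  have h2 : b ∈ G.neighborSet x := hb
  rw [hc] at h1 h2
  exact h1.trans h2.symm

lemma isLeaf_of_forall_adj {x a : V} (ha : G.Adj x a) (h : ∀ b, G.Adj x b → b = a) :
    isLeaf G x := by
  refine Set.ncard_eq_one.mpr ⟨a, Set.eq_singleton_iff_unique_mem.mpr ⟨ha, h⟩⟩

lemma isLeaf.not_isMajor {x : V} (h : isLeaf G x) : ¬ isMajor G x := by
  unfold isLeaf at h
  unfold isMajor
  omega

lemma isLeaf.dist_eq {x u v : V} (hG : G.Connected) (h : isLeaf G x) (ha : G.Adj x u)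
    (hv : x ≠ v) : G.dist x v = G.dist u v + 1 := by
  obtain ⟨p, hp, hd⟩ := hG.exists_adj_dist_eq_add_one hv
  rwa [h.eq_of_adj ha hp]

lemma isMajor_of_adj [Finite V] {m a b c : V} (ha : G.Adj m a) (hb : G.Adj m b) (hc : G.Adj m c)
    (hab : a ≠ b) (hac : a ≠ c) (hbc : b ≠ c) : isMajor G m := by
  have h : ({a, b, c} : Set V) ⊆ G.neighborSet m := by
    rintro z (rfl | rfl | rfl) <;> assumption
  have h3 : ({a, b, c} : Set V).ncard = 3 := Set.ncard_eq_three.mpr ⟨a, b, c, hab, hac, hbc, rfl⟩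
  unfold isMajor
  rw [← h3]
  exact Set.ncard_le_ncard h

lemma isMajor.exists_adj_ne [Finite V] {m : V} (h : isMajor G m) (a : V) :
    ∃ p q, G.Adj m p ∧ G.Adj m q ∧ p ≠ a ∧ q ≠ a ∧ p ≠ q := by
  have h2 : 1 < (G.neighborSet m \ {a}).ncard := by
    have := Set.le_ncard_sdiff {a} (G.neighborSet m)
    rw [Set.ncard_singleton] at this
    unfold isMajor at h
    omega
  obtain ⟨p, hp, q, hq, hpq⟩ := (Set.one_lt_ncard).mp h2
  exact ⟨p, q, hp.1, hq.1, hp.2, hq.2, hpq⟩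

lemma isTerminalOf.ne {u x : V} (h : isTerminalOf G u x) : u ≠ x := by
  rintro rfl
  exact h.1.not_isMajor h.2.1

lemma isTerminalOf.unique {u v x : V} (hu : isTerminalOf G u x) (hv : isTerminalOf G v x) :
    u = v := by
  by_contra hne
  have h1 := hu.2.2 v hv.2.1 (Ne.symm hne)
  have h2 := hv.2.2 u hu.2.1 hne
  omega

lemma isTerminalOf_of_adj {u x : V} (hG : G.Connected) (hu : isMajor G u) (hx : isLeaf G x)
    (h : G.Adj u x) : isTerminalOf G u x := by
  refine ⟨hx, hu, fun w hw hne => ?_⟩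
  have hxw : x ≠ w := by
    rintro rfl
    exact hx.not_isMajor hw
  have h1 := hx.dist_eq hG h.symm hxw
  have h2 := hG.pos_dist_of_ne (Ne.symm hne)
  rw [dist_eq_one_iff_adj.mpr h, dist_comm]
  omega

/-- A leaf of a branch at `m` without major vertices is a terminal vertex of `m`. -/
lemma isTerminalOf_of_branch (hG : G.IsTree) {m p x : V} (hm : isMajor G m) (h : G.Adj m p)
    (hx : isLeaf G x) (hpx : G.dist m x = G.dist p x + 1)
    (hno : ∀ w, isMajor G w → G.dist m w ≠ G.dist p w + 1) : isTerminalOf G m x := by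
  refine ⟨hx, hm, fun w hw hne => ?_⟩
  have h1 := hG.dist_eq_of_adj h hpx ((hG.dist_eq_add_one_or h w).resolve_left (hno w hw))
  have h2 := hG.connected.pos_dist_of_ne (Ne.symm hne)
  rw [dist_comm (u := w)]
  omega

/-- The branch at `u` that contains a terminal vertex `x` of `u` is the path from `x` to `u`. -/
lemma isTerminalOf.dist_add_dist [Finite V] (hG : G.IsTree) {u x p : V} (hx : isTerminalOf G u x)
    (h : G.Adj u p) (hpx : G.dist u x = G.dist p x + 1) :
    ∀ {v : V}, G.dist u v = G.dist p v + 1 → G.dist x v + G.dist v u = G.dist x u := by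
  have hconn := hG.connected
  suffices H : ∀ n v, G.dist x v = n → G.dist u v = G.dist p v + 1 →
      G.dist x v + G.dist v u = G.dist x u from fun {v} => H _ v rfl
  intro n
  induction n with
  | zero =>
    intro v hv _
    obtain rfl := hconn.dist_eq_zero_iff.mp hv
    simp
  | succ n ih =>
    intro v hv hpv
    have hne : v ≠ x := by
      rintro rfl
      simp at hv
    obtain ⟨v', hadj, hv'⟩ := hconn.exists_adj_dist_eq_add_one hne
    rw [dist_comm, dist_comm (u := v')] at hv'
    have hpv' : G.dist u v' = G.dist p v' + 1 := by
      rcases hG.dist_eq_add_one_or h v' with h1 | h1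
      · exact h1
      · exfalso
        have h2 := hG.dist_eq_of_adj h hpv h1
        rw [dist_eq_one_iff_adj.mpr hadj] at h2
        have h3 : p = v := hconn.dist_eq_zero_iff.mp (by omega)
        have h4 : u = v' := hconn.dist_eq_zero_iff.mp (by omega)
        subst h3 h4
        rw [dist_comm (u := x), dist_comm (u := x)] at hv'
        omega
    have hi := ih v' (by omega) hpv'
    have hv'u : v' ≠ u := by
      rintro rfl
      simp at hpv'
    obtain ⟨n', hn', hdn⟩ := hconn.exists_adj_dist_eq_add_one hv'u
    have hnv : n' = v := by
      by_cases hxv : v' = x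
      · subst hxv
        exact hx.1.eq_of_adj hn' hadj.symm
      · obtain ⟨q, hq, hdq⟩ := hconn.exists_adj_dist_eq_add_one hxv
        rw [dist_comm, dist_comm (u := q)] at hdq
        by_contra hne'
        have hmaj : isMajor G v' := by
          refine isMajor_of_adj hn' hadj.symm hq hne' ?_ ?_
          · rintro rfl
            have : G.dist x u ≤ G.dist x n' + G.dist n' u := hconn.dist_triangle
            omega
          · rintro rfl
            omega
        have h1 := hx.2.2 v' hmaj hv'u
        rw [dist_comm, dist_comm (u := v')] at h1
        omega
    subst hnv
    omega

lemma isTerminalOf.eq_of_branch [Finite V] (hG : G.IsTree) {u x y p : V} (hx : isTerminalOf G u x)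
    (hy : isTerminalOf G u y) (h : G.Adj u p) (hpx : G.dist u x = G.dist p x + 1)
    (hpy : G.dist u y = G.dist p y + 1) : x = y := by
  have h1 := hx.dist_add_dist hG h hpx hpy
  have h2 := hy.dist_add_dist hG h hpy hpx
  rw [dist_comm (u := y) (v := x)] at h2
  exact hG.connected.dist_eq_zero_iff.mp (by omega)

lemma isTerminalOf.not_isMajor_of_branch [Finite V] (hG : G.IsTree) {u x p w : V}
    (hx : isTerminalOf G u x) (h : G.Adj u p) (hpx : G.dist u x = G.dist p x + 1)
    (hpw : G.dist u w = G.dist p w + 1) : ¬ isMajor G w := by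
  intro hw
  have h1 := hx.dist_add_dist hG h hpx hpw
  have h2 := hx.2.2 w hw (by rintro rfl; simp at hpw)
  rw [dist_comm (u := u), dist_comm (u := w)] at h2
  omega

/-- Branches of terminal vertices of distinct major vertices are disjoint. -/
lemma isTerminalOf.eq_of_mem_branches [Finite V] (hG : G.IsTree) {u u' x x' p p' v : V}
    (hx : isTerminalOf G u x) (hx' : isTerminalOf G u' x') (h : G.Adj u p) (h' : G.Adj u' p')
    (hpx : G.dist u x = G.dist p x + 1) (hpx' : G.dist u' x' = G.dist p' x' + 1)
    (hv : G.dist u v = G.dist p v + 1) (hv' : G.dist u' v = G.dist p' v + 1) : x = x' := by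
  by_cases huu : u = u'
  · subst huu
    obtain rfl := hG.eq_of_dist_eq_add_one h h' hv hv'
    exact hx.eq_of_branch hG hx' h hpx hpx'
  · exfalso
    have h1 := hG.dist_eq_of_adj h hv ((hG.dist_eq_add_one_or h u').resolve_left
      fun hc => hx.not_isMajor_of_branch hG h hpx hc hx'.2.1)
    have h2 := hG.dist_eq_of_adj h' hv' ((hG.dist_eq_add_one_or h' u).resolve_left
      fun hc => hx'.not_isMajor_of_branch hG h' hpx' hc hx.2.1)
    have h3 := hG.connected.pos_dist_of_ne huu
    rw [dist_comm (u := v), dist_comm (u := u)] at h1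
    rw [dist_comm (u := v)] at h2
    rw [dist_comm (u := u) (v := u')] at h3
    omega

/-- A branch of a tree that misses a set `R` containing all but at most one terminal vertex of each
vertex has no major vertex. -/
lemma branch_of_disjoint [Finite V] (hG : G.IsTree) {R : Set V}
    (hR : ∀ u x y, isTerminalOf G u x → isTerminalOf G u y → x ≠ y → x ∈ R ∨ y ∈ R)
    {m p : V} (h : G.Adj m p) (hmiss : ∀ r ∈ R, G.dist m r ≠ G.dist p r + 1) :
    (∀ w, isMajor G w → G.dist m w ≠ G.dist p w + 1) ∧
      ∃ x, isLeaf G x ∧ G.dist m x = G.dist p x + 1 := by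
  induction hn : {v | G.dist m v = G.dist p v + 1}.ncard using Nat.strong_induction_on
    generalizing m p with
  | _ n ih =>
  have hsub : ∀ {q}, G.Adj p q → q ≠ m → ∀ {v}, G.dist p v = G.dist q v + 1 →
      G.dist m v = G.dist p v + 1 := by
    intro q hq hqm v hv
    refine (hG.dist_eq_add_one_or h v).resolve_right fun hc => hqm ?_
    exact hG.eq_of_dist_eq_add_one hq h.symm hv hc
  have hmp : G.dist m p = G.dist p p + 1 := by
    rw [dist_eq_one_iff_adj.mpr h, dist_self]
  have key : ∀ q, G.Adj p q → q ≠ m →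
      (∀ w, isMajor G w → G.dist p w ≠ G.dist q w + 1) ∧
        ∃ x, isLeaf G x ∧ G.dist p x = G.dist q x + 1 := by
    intro q hq hqm
    refine ih _ ?_ hq (fun r hr hc => hmiss r hr (hsub hq hqm hc)) rfl
    rw [← hn]
    refine Set.ncard_lt_ncard ?_
    refine Set.ssubset_iff_of_subset (fun v hv => hsub hq hqm hv) |>.mpr ⟨p, hmp, fun hc => ?_⟩
    have hc' : G.dist p p = G.dist q p + 1 := hc
    simp at hc'
  have hp : ¬ isMajor G p := by
    intro hmaj
    obtain ⟨q, q', hq, hq', hqm, hqm', hne⟩ := hmaj.exists_adj_ne m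
    obtain ⟨h1, x, hx, hxq⟩ := key q hq hqm
    obtain ⟨h2, y, hy, hyq⟩ := key q' hq' hqm'
    have hxy : x ≠ y := by
      rintro rfl
      exact hne (hG.eq_of_dist_eq_add_one hq hq' hxq hyq)
    rcases hR p x y (isTerminalOf_of_branch hG hmaj hq hx hxq h1)
      (isTerminalOf_of_branch hG hmaj hq' hy hyq h2) hxy with hr | hr
    · exact hmiss x hr (hsub hq hqm hxq)
    · exact hmiss y hr (hsub hq' hqm' hyq)
  constructor
  · intro w hw hmw
    have hne : p ≠ w := by
      rintro rfl
      exact hp hw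
    obtain ⟨q, hq, hd⟩ := hG.connected.exists_adj_dist_eq_add_one hne
    refine (key q hq ?_).1 w hw hd
    rintro rfl
    omega
  · by_cases hex : ∃ q, G.Adj p q ∧ q ≠ m
    · obtain ⟨q, hq, hqm⟩ := hex
      obtain ⟨_, x, hx, hxq⟩ := key q hq hqm
      exact ⟨x, hx, hsub hq hqm hxq⟩
    · push Not at hex
      exact ⟨p, isLeaf_of_forall_adj h.symm hex, hmp⟩

lemma not_isMajor_of_disjoint [Finite V] (hG : G.IsTree) {R : Set V}
    (hR : ∀ u x y, isTerminalOf G u x → isTerminalOf G u y → x ≠ y → x ∈ R ∨ y ∈ R)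
    {m p q : V} (hp : G.Adj m p) (hq : G.Adj m q) (hpq : p ≠ q)
    (hmp : ∀ r ∈ R, G.dist m r ≠ G.dist p r + 1) (hmq : ∀ r ∈ R, G.dist m r ≠ G.dist q r + 1) :
    ¬ isMajor G m := by
  intro hmaj
  obtain ⟨h1, x, hx, hxp⟩ := branch_of_disjoint hG hR hp hmp
  obtain ⟨h2, y, hy, hyq⟩ := branch_of_disjoint hG hR hq hmq
  have hxy : x ≠ y := by
    rintro rfl
    exact hpq (hG.eq_of_dist_eq_add_one hp hq hxp hyq)
  rcases hR m x y (isTerminalOf_of_branch hG hmaj hp hx hxp h1)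
    (isTerminalOf_of_branch hG hmaj hq hy hyq h2) hxy with hr | hr
  · exact hmp x hr hxp
  · exact hmq y hr hyq

/-- In a tree with a major vertex, a set containing all but at most one terminal vertex of each
vertex is resolving. -/
lemma isResolvingSet_of_isTerminalOf [Finite V] (hG : G.IsTree) {R : Set V}
    (hmaj : ∃ w, isMajor G w)
    (hR : ∀ u x y, isTerminalOf G u x → isTerminalOf G u y → x ≠ y → x ∈ R ∨ y ∈ R) :
    isResolvingSet G R := by
  obtain ⟨w, hw⟩ := hmaj
  have hconn := hG.connected
  have hne : R.Nonempty := by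
    by_contra hemp
    rw [Set.not_nonempty_iff_eq_empty] at hemp
    obtain ⟨p, q, hp, hq, -, -, hpq⟩ := hw.exists_adj_ne w
    exact not_isMajor_of_disjoint hG hR hp hq hpq (by simp [hemp]) (by simp [hemp]) hw
  intro x y hxy
  by_contra! hun
  obtain ⟨s, hs⟩ := hne
  have heven := hG.even_dist_add_dist_add_dist s x y
  rw [hun s hs] at heven
  have hpos := hconn.pos_dist_of_ne hxy
  obtain ⟨k, hk⟩ : ∃ k, G.dist x y = 2 * k := by
    refine ⟨G.dist x y / 2, ?_⟩
    rw [Nat.even_iff] at heven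
    omega
  obtain ⟨m, hxm, hmy⟩ := hconn.exists_dist_eq_add x y (k := k) (by omega)
  rw [dist_comm] at hxm
  obtain ⟨p, hp, hpd⟩ := hconn.exists_adj_dist_eq_add_one (u := m) (v := x) (by
    rintro rfl
    simp at hxm
    omega)
  obtain ⟨q, hq, hqd⟩ := hconn.exists_adj_dist_eq_add_one (u := m) (v := y) (by
    rintro rfl
    simp at hmy
    omega)
  have hpq : p ≠ q := by
    rintro rfl
    have : G.dist x y ≤ G.dist x p + G.dist p y := hconn.dist_triangle
    rw [dist_comm (u := x) (v := p)] at this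
    omega
  have hfar : ∀ {a b c d r : V}, G.Adj m a → G.Adj m b → a ≠ b → G.dist m c = G.dist a c + 1 →
      G.dist m d = G.dist b d + 1 → G.dist m c = G.dist m d → G.dist r c = G.dist r d →
      G.dist m r ≠ G.dist a r + 1 := by
    intro a b c d r ha hb hab hc hd hcd hr hmr
    have h1 := hG.dist_eq_of_adj ha hmr ((hG.dist_eq_add_one_or ha d).resolve_left
      fun h => hab (hG.eq_of_dist_eq_add_one ha hb h hd))
    have h2 : G.dist r c ≤ G.dist r a + G.dist a c := hconn.dist_triangle
    rw [dist_comm (u := r) (v := a)] at h2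
    omega
  have hmp : ∀ r ∈ R, G.dist m r ≠ G.dist p r + 1 := fun r hr =>
    hfar hp hq hpq hpd hqd (by omega) (hun r hr)
  have hmq : ∀ r ∈ R, G.dist m r ≠ G.dist q r + 1 := fun r hr =>
    hfar hq hp hpq.symm hqd hpd (by omega) (hun r hr).symm
  have hm := not_isMajor_of_disjoint hG hR hp hq hpq hmp hmq
  obtain ⟨n, hn, hnd⟩ := hconn.exists_adj_dist_eq_add_one (u := m) (v := w) (by
    rintro rfl
    exact hm hw)
  by_cases hpn : p = n
  · subst hpn
    exact (branch_of_disjoint hG hR hp hmp).1 w hw hnd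
  by_cases hqn : q = n
  · subst hqn
    exact (branch_of_disjoint hG hR hq hmq).1 w hw hnd
  exact hm (isMajor_of_adj hp hq hn hpq hpn hqn)

/-- A finite tree without major vertices is a path. -/
lemma isPathGraph_of_forall_not_isMajor [Fintype V] (hG : G.IsTree)
    (h : ∀ v, ¬ isMajor G v) : isPathGraph G := by
  have hconn := hG.connected
  obtain ⟨r⟩ := hconn.nonempty
  have : Nonempty V := ⟨r⟩
  obtain ⟨l, hl⟩ := Finite.exists_max (fun v => G.dist v r)
  have hl1 : ∀ a b, G.Adj l a → G.Adj l b → a = b := by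
    intro a b ha hb
    have := hl a
    have := hl b
    refine hG.eq_of_dist_eq_add_one (v := r) ha hb ?_ ?_
    · rcases hG.dist_eq_add_one_or ha r with h1 | h1 <;> omega
    · rcases hG.dist_eq_add_one_or hb r with h1 | h1 <;> omega
  have hinj : ∀ n a b, G.dist a l = n → G.dist b l = n → a = b := by
    intro n
    induction n with
    | zero =>
      intro a b ha hb
      rw [hconn.dist_eq_zero_iff.mp ha, hconn.dist_eq_zero_iff.mp hb]
    | succ n ih =>
      intro a b ha hb
      obtain ⟨a', haa, hda⟩ := hconn.exists_adj_dist_eq_add_one (u := a) (v := l) (by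
        rintro rfl
        simp at ha)
      obtain ⟨b', hbb, hdb⟩ := hconn.exists_adj_dist_eq_add_one (u := b) (v := l) (by
        rintro rfl
        simp at hb)
      obtain rfl := ih a' b' (by omega) (by omega)
      by_cases hal : a' = l
      · subst hal
        exact hl1 a b haa.symm hbb.symm
      · obtain ⟨c, hc, hdc⟩ := hconn.exists_adj_dist_eq_add_one hal
        by_contra hab
        refine h a' (isMajor_of_adj haa.symm hbb.symm hc hab ?_ ?_)
        · rintro rfl
          omega
        · rintro rfl
          omega
  have hlt : ∀ v, G.dist v l < Fintype.card V := by
    intro v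
    obtain ⟨t, ht, htl⟩ := hconn.exists_path_of_dist v l
    rw [← htl]
    exact ht.length_lt
  let f : V → Fin (Fintype.card V) := fun v => ⟨G.dist v l, hlt v⟩
  have hf : Function.Injective f := fun a b hab => hinj _ a b rfl (congrArg Fin.val hab).symm
  have hbij : Function.Bijective f :=
    (Fintype.bijective_iff_injective_and_card f).mpr ⟨hf, by simp⟩
  refine ⟨Fintype.card V, ⟨⟨Equiv.ofBijective f hbij, ?_⟩⟩⟩
  have hstep : ∀ {a b}, G.dist b l = G.dist a l + 1 → G.Adj a b := by
    intro a b hab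
    obtain ⟨c, hc, hd⟩ := hconn.exists_adj_dist_eq_add_one (u := b) (v := l) (by
      rintro rfl
      simp at hab)
    obtain rfl := hinj _ a c rfl (by omega)
    exact hc.symm
  intro a b
  rw [pathGraph_adj]
  change G.dist a l + 1 = G.dist b l ∨ G.dist b l + 1 = G.dist a l ↔ _
  constructor
  · rintro (h1 | h1)
    · exact hstep h1.symm
    · exact (hstep h1.symm).symm
  · intro hab
    rcases hG.dist_eq_add_one_or hab l with h1 | h1
    · exact Or.inr h1.symm
    · exact Or.inl h1.symm

/-- In a tree with a major vertex, a vertex adjacent to two leaves is major. -/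
lemma isMajor_of_adj_leaves [Finite V] (hG : G.IsTree) (hmaj : ∃ w, isMajor G w) {m a b : V}
    (hab : a ≠ b) (ha : isLeaf G a) (hb : isLeaf G b) (hma : G.Adj m a) (hmb : G.Adj m b) :
    isMajor G m := by
  obtain ⟨w, hw⟩ := hmaj
  by_contra hm
  obtain ⟨n, hn, hd⟩ := hG.connected.exists_adj_dist_eq_add_one (u := m) (v := w) (by
    rintro rfl
    exact hm hw)
  have key : ∀ {c}, isLeaf G c → G.Adj m c → c ≠ n := by
    rintro c hc hmc rfl
    have := hc.dist_eq hG.connected hmc.symm (v := w) (by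
      rintro rfl
      exact hc.not_isMajor hw)
    omega
  exact hm (isMajor_of_adj hma hmb hn hab (key ha hma) (key hb hmb))

/-- In a tree, a dominating set which contains one of any two leaves with a common neighbor is
resolving. -/
lemma isDominatingSet.isResolvingSet (hG : G.IsTree) {S : Set V} (hS : isDominatingSet G S)
    (htwin : ∀ m a b, a ≠ b → isLeaf G a → isLeaf G b → G.Adj m a → G.Adj m b → a ∈ S ∨ b ∈ S) :
    isResolvingSet G S := by
  have hconn := hG.connected
  intro x y hxy
  by_contra! hun
  have key : ∀ {a b m : V}, a ≠ b → (∀ s ∈ S, G.dist s a = G.dist s b) → m ∈ S → G.Adj a m →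
      G.Adj b m → isLeaf G a := by
    intro a b m hab hun hm ham hbm
    have hmb : G.dist m b = 1 := dist_eq_one_iff_adj.mpr hbm.symm
    have hpos := hconn.pos_dist_of_ne hab
    have hab2 : G.dist a b = G.dist m b + 1 := by
      rcases hG.dist_eq_add_one_or ham b with h1 | h1 <;> omega
    refine isLeaf_of_forall_adj ham fun z hz => ?_
    by_contra hzm
    have hzb : G.dist z b = G.dist a b + 1 := (hG.dist_eq_add_one_or hz b).resolve_left
      fun h1 => hzm (hG.eq_of_dist_eq_add_one hz ham h1 hab2)
    have hza : G.dist z a = 1 := dist_eq_one_iff_adj.mpr hz.symm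
    have hzS : z ∉ S := by
      intro h1
      have := hun z h1
      omega
    obtain ⟨w, hw, hwz⟩ := hS z hzS
    have hwa : w ≠ a := by
      rintro rfl
      have := hun w hw
      rw [dist_self] at this
      omega
    refine hwa (hG.eq_of_dist_eq_add_one hwz.symm hz.symm (v := b) ?_ hzb)
    have h1 := hun w hw
    have h2 := hconn.pos_dist_of_ne hwa
    rcases hG.dist_eq_add_one_or hwz a with h3 | h3 <;> omega
  have hx : x ∉ S := by
    intro hx
    have h1 := hun x hx
    have h2 := hconn.pos_dist_of_ne hxy
    rw [dist_self] at h1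
    omega
  have hy : y ∉ S := by
    intro hy
    have h1 := hun y hy
    have h2 := hconn.pos_dist_of_ne hxy.symm
    rw [dist_self] at h1
    omega
  obtain ⟨m, hm, hmx⟩ := hS x hx
  have hmy : G.Adj m y := by
    rw [← dist_eq_one_iff_adj, ← hun m hm, dist_eq_one_iff_adj]
    exact hmx
  have hlx := key hxy hun hm hmx.symm hmy.symm
  have hly := key hxy.symm (fun s hs => (hun s hs).symm) hm hmy.symm hmx.symm
  rcases htwin m x y hxy hlx hly hmx hmy with h | h
  · exact hx h
  · exact hy h

lemma isResolvingSet.mem_or_mem_of_leaves (hG : G.Connected) {S : Set V} (hS : isResolvingSet G S)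
    {m a b : V} (hab : a ≠ b) (ha : isLeaf G a) (hb : isLeaf G b) (hma : G.Adj m a)
    (hmb : G.Adj m b) : a ∈ S ∨ b ∈ S := by
  obtain ⟨s, hs, hd⟩ := hS a b hab
  by_contra! hc
  apply hd
  rw [dist_comm, dist_comm (v := b), ha.dist_eq hG hma.symm (by rintro rfl; exact hc.1 hs),
    hb.dist_eq hG hmb.symm (by rintro rfl; exact hc.2 hs)]

/-- A resolving set of a tree is at least as large as some set of leaves which contains all but at
most one terminal vertex of each vertex. -/
lemma isResolvingSet.exists_ncard_le [Finite V] (hG : G.IsTree) {R : Set V}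
    (hR : isResolvingSet G R) :
    ∃ C : Set V, C.ncard ≤ R.ncard ∧
      ∀ u x y, isTerminalOf G u x → isTerminalOf G u y → x ≠ y → x ∈ C ∨ y ∈ C := by
  let P : V → V → Prop := fun x r => ∃ u p, isTerminalOf G u x ∧ G.Adj u p ∧
    G.dist u x = G.dist p x + 1 ∧ G.dist u r = G.dist p r + 1
  refine ⟨{x | ∃ r ∈ R, P x r}, ?_, ?_⟩
  · choose! f hf using fun (x : V) (hx : x ∈ {x | ∃ r ∈ R, P x r}) => hx
    refine Set.ncard_le_ncard_of_injOn f (fun x hx => (hf x hx).1) ?_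
    intro x hx y hy hxy
    obtain ⟨u, p, hu, hp, hpx, hpr⟩ := (hf x hx).2
    obtain ⟨u', p', hu', hp', hpx', hpr'⟩ := (hf y hy).2
    rw [← hxy] at hpr'
    exact hu.eq_of_mem_branches hG hu' hp hp' hpx hpx' hpr hpr'
  · intro u x y hx hy hxy
    obtain ⟨p, hp, hpx⟩ := hG.connected.exists_adj_dist_eq_add_one hx.ne
    obtain ⟨q, hq, hqy⟩ := hG.connected.exists_adj_dist_eq_add_one hy.ne
    have hpq : p ≠ q := by
      rintro rfl
      exact hxy (hx.eq_of_branch hG hy hp hpx hqy)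
    obtain ⟨r, hr, hd⟩ := hR p q hpq
    by_contra! hc
    simp only [Set.mem_ofPred_eq, not_exists, not_and] at hc
    apply hd
    rw [dist_comm, dist_comm (v := q),
      (hG.dist_eq_add_one_or hp r).resolve_left fun h => hc.1 r hr ⟨u, p, hx, hp, hpx, h⟩,
      (hG.dist_eq_add_one_or hq r).resolve_left fun h => hc.2 r hr ⟨u, q, hy, hq, hqy, h⟩]

lemma isResolvingSet.mono {S T : Set V} (h : isResolvingSet G S) (hST : S ⊆ T) :
    isResolvingSet G T := fun x y hxy =>
  let ⟨u, hu, hd⟩ := h x y hxy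
  ⟨u, hST hu, hd⟩

lemma isDominatingSet.mono {S T : Set V} (h : isDominatingSet G S) (hST : S ⊆ T) :
    isDominatingSet G T := fun x hx =>
  let ⟨u, hu, hd⟩ := h x fun hc => hx (hST hc)
  ⟨u, hST hu, hd⟩

lemma isDominatingSet_univ : isDominatingSet G Set.univ := fun x hx => absurd (Set.mem_univ x) hx

lemma isResolvingSet_univ (hG : G.Connected) : isResolvingSet G Set.univ := fun x y hxy =>
  ⟨x, Set.mem_univ x, by rw [dist_self]; exact (hG.pos_dist_of_ne hxy).ne⟩

lemma exists_ncard_eq_metricDim (hG : G.Connected) :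
    ∃ R, isResolvingSet G R ∧ R.ncard = metricDim G :=
  Nat.sInf_mem (s := {n | ∃ S : Set V, isResolvingSet G S ∧ S.ncard = n})
    ⟨_, _, isResolvingSet_univ hG, rfl⟩

variable (G) in
lemma exists_ncard_eq_domNum : ∃ D, isDominatingSet G D ∧ D.ncard = domNum G :=
  Nat.sInf_mem (s := {n | ∃ S : Set V, isDominatingSet G S ∧ S.ncard = n})
    ⟨_, _, isDominatingSet_univ, rfl⟩

lemma exists_ncard_eq_mldNum (hG : G.Connected) : ∃ S, isMLDSet G S ∧ S.ncard = mldNum G :=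
  Nat.sInf_mem (s := {n | ∃ S : Set V, isMLDSet G S ∧ S.ncard = n})
    ⟨_, _, ⟨isResolvingSet_univ hG, isDominatingSet_univ⟩, rfl⟩

lemma mldNum_le_metricDim_add_domNum (hG : G.Connected) :
    mldNum G ≤ metricDim G + domNum G := by
  obtain ⟨R, hR, hRc⟩ := exists_ncard_eq_metricDim hG
  obtain ⟨D, hD, hDc⟩ := exists_ncard_eq_domNum G
  rw [← hRc, ← hDc]
  have h : mldNum G ≤ (R ∪ D).ncard := Nat.sInf_le
    ⟨_, ⟨hR.mono Set.subset_union_left, hD.mono Set.subset_union_right⟩, rfl⟩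
  exact h.trans (Set.ncard_union_le _ _)

lemma mldNum_lt_metricDim_add_domNum [Finite V] (hG : G.IsTree) (hmaj : ∃ w, isMajor G w) {u x : V}
    (hu : 2 ≤ terDeg G u) (hx : isTerminalOf G u x) (hux : ¬ G.Adj u x) :
    mldNum G < metricDim G + domNum G := by
  have hconn := hG.connected
  obtain ⟨R, hR, hRc⟩ := exists_ncard_eq_metricDim hconn
  obtain ⟨D, hD, hDc⟩ := exists_ncard_eq_domNum G
  obtain ⟨C, hCR, hC⟩ := hR.exists_ncard_le hG
  have hterm : ∀ {m a b}, a ≠ b → isLeaf G a → isLeaf G b → G.Adj m a → G.Adj m b →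
      isTerminalOf G m a ∧ isTerminalOf G m b := fun hab ha hb hma hmb =>
    have hm := isMajor_of_adj_leaves hG hmaj hab ha hb hma hmb
    ⟨isTerminalOf_of_adj hconn hm ha hma, isTerminalOf_of_adj hconn hm hb hmb⟩
  obtain ⟨z, hz, hzC⟩ : ∃ z ∈ C, ∀ m b, b ≠ z → isTerminalOf G m z → isTerminalOf G m b →
      G.Adj m z → G.Adj m b → b ∈ C := by
    by_cases hxC : x ∈ C
    · refine ⟨x, hxC, fun m b _ hmx _ hadj => absurd ?_ hux⟩
      rwa [hx.unique hmx]
    · obtain ⟨z, hz, hzx⟩ := Set.exists_ne_of_one_lt_ncard (s := {x | isTerminalOf G u x}) hu x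
      refine ⟨z, (hC u z x hz hx hzx).resolve_right hxC, fun m b _ hmz hmb _ hadj => ?_⟩
      obtain rfl := hmz.unique hz
      refine (hC m b x hmb hx ?_).resolve_right hxC
      rintro rfl
      exact hux hadj
  have hdom : isDominatingSet G (D ∪ C \ {z}) := hD.mono Set.subset_union_left
  have hres : isResolvingSet G (D ∪ C \ {z}) := by
    refine hdom.isResolvingSet hG fun m a b hab ha hb hma hmb => ?_
    obtain ⟨hta, htb⟩ := hterm hab ha hb hma hmb
    by_cases haz : a = z
    · subst haz
      exact Or.inr (Or.inr ⟨hzC m b hab.symm hta htb hma hmb, hab.symm⟩)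
    by_cases hbz : b = z
    · subst hbz
      exact Or.inl (Or.inr ⟨hzC m a hab htb hta hmb hma, hab⟩)
    exact (hC m a b hta htb hab).imp (fun h => Or.inr ⟨h, haz⟩) (fun h => Or.inr ⟨h, hbz⟩)
  have h1 : mldNum G ≤ (D ∪ C \ {z}).ncard := Nat.sInf_le ⟨_, ⟨hres, hdom⟩, rfl⟩
  have h2 := Set.ncard_union_le D (C \ {z})
  have h3 := Set.ncard_sdiff_singleton_lt_of_mem hz
  omega

lemma metricDim_add_domNum_le_mldNum [Finite V] (hG : G.IsTree) (hmaj : ∃ w, isMajor G w)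
    (h : ∀ u, isMajor G u → 2 ≤ terDeg G u → ∀ x, isTerminalOf G u x → G.Adj u x) :
    metricDim G + domNum G ≤ mldNum G := by
  classical
  have hconn := hG.connected
  obtain ⟨S, ⟨hres, hdom⟩, hSc⟩ := exists_ncard_eq_mldNum hconn
  have hadj : ∀ {u x y}, isTerminalOf G u x → isTerminalOf G u y → x ≠ y → G.Adj u x := by
    intro u x y hx hy hxy
    exact h u hx.2.1 ((Set.one_lt_ncard (s := {x | isTerminalOf G u x})).mpr
      ⟨x, hx, y, hy, hxy⟩) x hx
  have hone : ∀ {u x y}, isTerminalOf G u x → isTerminalOf G u y → x ≠ y → x ∈ S ∨ y ∈ S :=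
    fun hx hy hxy => hres.mem_or_mem_of_leaves hconn hxy hx.1 hy.1 (hadj hx hy hxy)
      (hadj hy hx hxy.symm)
  have he : ∀ u, (∃ x, isTerminalOf G u x) → ∃ e, isTerminalOf G u e ∧
      ∀ y, isTerminalOf G u y → y ≠ e → y ∈ S := by
    rintro u ⟨x, hx⟩
    by_cases hex : ∃ e, isTerminalOf G u e ∧ e ∉ S
    · obtain ⟨e, hte, heS⟩ := hex
      exact ⟨e, hte, fun y hy hye => (hone hy hte hye).resolve_right heS⟩
    · push Not at hex
      exact ⟨x, hx, fun y hy _ => hex y hy⟩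
  choose! e hte heS using he
  let R : Set V := {y | ∃ u, isTerminalOf G u y ∧ y ≠ e u}
  have hRS : R ⊆ S := fun y ⟨u, hy, hne⟩ => heS u ⟨y, hy⟩ y hy hne
  have hRres : isResolvingSet G R := by
    refine isResolvingSet_of_isTerminalOf hG hmaj fun u x y hx hy hxy => ?_
    by_cases hxe : x = e u
    · exact Or.inr ⟨u, hy, fun hye => hxy (hxe.trans hye.symm)⟩
    · exact Or.inl ⟨u, hx, hxe⟩
  let A : V → V → Prop := fun s u => isTerminalOf G u s ∧ G.Adj u s
  let f : V → V := fun s => if hs : ∃ u, A s u then hs.choose else s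
  have hfA : ∀ {s u}, A s u → f s = u := by
    intro s u hs
    have hex : ∃ u, A s u := ⟨u, hs⟩
    have h1 : f s = hex.choose := dif_pos hex
    rw [h1]
    exact hex.choose_spec.1.unique hs.1
  have hfn : ∀ {s}, (¬ ∃ u, A s u) → f s = s := fun hs => dif_neg hs
  have hmem : ∀ {s u}, A s u → u ∈ f '' (S \ R) := by
    intro s u hs
    have hte := hte u ⟨s, hs.1⟩
    have hAe : A (e u) u := by
      refine ⟨hte, ?_⟩
      by_cases hse : s = e u
      · exact hse ▸ hs.2
      · exact hadj hte hs.1 (Ne.symm hse)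
    by_cases heS' : e u ∈ S
    · refine ⟨e u, ⟨heS', ?_⟩, hfA hAe⟩
      rintro ⟨v, hv, hne⟩
      exact hne (by rw [hv.unique hte])
    · obtain ⟨t, htS, ht⟩ := hdom _ heS'
      obtain rfl := hte.1.eq_of_adj ht.symm hAe.2.symm
      refine ⟨t, ⟨htS, ?_⟩, hfn ?_⟩
      · rintro ⟨v, hv, -⟩
        exact hv.1.not_isMajor hte.2.1
      · rintro ⟨v, hv, -⟩
        exact hv.1.not_isMajor hte.2.1
  have hD : isDominatingSet G (f '' (S \ R)) := by
    intro v hv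
    obtain ⟨s, hs, hsv⟩ : ∃ s ∈ S, s = v ∨ G.Adj s v := by
      by_cases hvS : v ∈ S
      · exact ⟨v, hvS, Or.inl rfl⟩
      · obtain ⟨s, hs, hsv⟩ := hdom v hvS
        exact ⟨s, hs, Or.inr hsv⟩
    by_cases hA : ∃ u, A s u
    · obtain ⟨u, hA⟩ := hA
      rcases hsv with rfl | hsv
      · exact ⟨u, hmem hA, hA.2⟩
      · obtain rfl := hA.1.1.eq_of_adj hA.2.symm hsv
        exact absurd (hmem hA) hv
    · have hsD : s ∈ f '' (S \ R) := by
        refine ⟨s, ⟨hs, ?_⟩, hfn hA⟩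
        rintro ⟨u, hu, hne⟩
        exact hA ⟨u, hu, hadj hu (hte u ⟨s, hu⟩) hne⟩
      rcases hsv with rfl | hsv
      · exact absurd hsD hv
      · exact ⟨s, hsD, hsv⟩
  have h1 : metricDim G ≤ R.ncard := Nat.sInf_le ⟨_, hRres, rfl⟩
  have h2 : domNum G ≤ (f '' (S \ R)).ncard := Nat.sInf_le ⟨_, hD, rfl⟩
  have h3 : (f '' (S \ R)).ncard ≤ (S \ R).ncard := Set.ncard_image_le
  have h4 := Set.ncard_sdiff_add_ncard_of_subset hRS
  omega

end

theorem stmt2 {V : Type*} [Fintype V] (G : SimpleGraph V)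
    (htree : G.IsTree) (hcard : 2 ≤ Fintype.card V) (hnp : ¬ isPathGraph G) :
    mldNum G = metricDim G + domNum G ↔
      ∀ u : V, isMajor G u → 2 ≤ terDeg G u →
        ∀ x : V, isTerminalOf G u x → G.Adj u x := by
  have hmaj : ∃ w, isMajor G w := by
    by_contra! hno
    exact hnp (isPathGraph_of_forall_not_isMajor htree hno)
  refine ⟨fun heq u _ hu x hx => ?_, fun h => ?_⟩
  · by_contra hux
    exact (mldNum_lt_metricDim_add_domNum htree hmaj hu hx hux).ne heq
  · exact (mldNum_le_metricDim_add_domNum htree.connected).antisymm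
      (metricDim_add_domNum_le_mldNum htree hmaj h)
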